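/- arXiv:1405.5975 — 2 statements merged into one kernel-verified Lean document; each statement's English description precedes it below -/
import Mathlib

section
/- There exist a constant C > 0 and an integer K₀ such that for every integer K ≥ K₀, setting x = K^{−2/K} (i.e., x = exp(−2·ln K / K)), one has 1 − (1−x)·(1−x²) − x^{K+1}/(x+1) + (x⁴ + (K−2)·x² − K)·x^{2K}/(x+1) ≥ 1 − C·(ln K)²/K². -/
/-- there exist C > 0 and K₀ such that for every K ≥ K₀, with
    x = K^{−2/K} = exp(−2·ln K/K):
    1 − (1−x)·(1−x²) − x^{K+1}/(x+1) + (x⁴+(K−2)·x²−K)·x^{2K}/(x+1) ≥ 1 − C·(ln K)²/K². -/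
theorem stmt17 :
    ∃ C : ℝ, 0 < C ∧ ∃ K₀ : ℕ, ∀ K : ℕ, K₀ ≤ K →
      (fun x : ℝ =>
        1 - (1 - x) * (1 - x ^ 2) - x ^ (K + 1) / (x + 1) +
            (x ^ 4 + ((K : ℝ) - 2) * x ^ 2 - (K : ℝ)) * x ^ (2 * K) / (x + 1))
          (Real.exp (-2 * Real.log K / K)) ≥
        1 - C * (Real.log K) ^ 2 / (K : ℝ) ^ 2 := by
  refine ⟨10, by norm_num, 3, fun K hK => ?_⟩
  have hK3 : (3 : ℝ) ≤ K := by exact_mod_cast hK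
  have hK0 : (0 : ℝ) < K := by linarith
  have hlog : 1 ≤ Real.log K := by
    rw [Real.le_log_iff_exp_le hK0]
    linarith [Real.exp_one_lt_three]
  set x := Real.exp (-2 * Real.log K / K) with hx
  have hx0 : 0 < x := Real.exp_pos _
  have hx1 : x ≤ 1 := by
    rw [hx, Real.exp_le_one_iff]
    exact div_nonpos_of_nonpos_of_nonneg (by linarith) hK0.le
  have hxK : x ^ K = 1 / (K : ℝ) ^ 2 := by
    rw [hx, ← Real.exp_nat_mul, mul_div_cancel₀ _ hK0.ne',
      show -2 * Real.log K = -(Real.log K + Real.log K) by ring, Real.exp_neg, Real.exp_add,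
      Real.exp_log hK0, one_div, sq]
  have hsub : 1 - x ≤ 2 * (Real.log K / K) := by
    have h := Real.add_one_le_exp (-2 * Real.log K / K)
    rw [← hx] at h
    have : -2 * Real.log K / K = -(2 * (Real.log K / K)) := by ring
    linarith
  have hfirst : (1 - x) * (1 - x ^ 2) ≤ 8 * (Real.log K / K) ^ 2 := by
    have h := pow_le_pow_left₀ (by linarith : 0 ≤ 1 - x) hsub 2
    nlinarith [mul_nonneg (sq_nonneg (1 - x)) (by linarith : 0 ≤ 1 - x)]
  have hinv : 1 / (K : ℝ) ^ 2 ≤ (Real.log K / K) ^ 2 := by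
    rw [div_pow]
    gcongr
    nlinarith
  have hsecond : x ^ (K + 1) / (x + 1) ≤ 1 / (K : ℝ) ^ 2 := by
    rw [pow_succ, hxK, div_le_iff₀ (by linarith)]
    gcongr
    linarith
  have hthird : -(1 / (K : ℝ) ^ 2) ≤
      (x ^ 4 + ((K : ℝ) - 2) * x ^ 2 - K) * x ^ (2 * K) / (x + 1) := by
    have hcoef : -(K : ℝ) ≤ x ^ 4 + ((K : ℝ) - 2) * x ^ 2 - K := by
      have : 0 ≤ ((K : ℝ) - 2) * x ^ 2 := mul_nonneg (by linarith) (sq_nonneg x)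
      have : 0 < x ^ 4 := by positivity
      linarith
    have hdecay : (K : ℝ) * (1 / (K : ℝ) ^ 2) ≤ 1 := by
      rw [mul_one_div, div_le_one (by positivity)]
      nlinarith
    have hpos : 0 < 1 / (K : ℝ) ^ 2 := by positivity
    rw [mul_comm 2 K, pow_mul, hxK, le_div_iff₀ (by linarith)]
    have h := mul_le_mul_of_nonneg_right hcoef (sq_nonneg (1 / (K : ℝ) ^ 2))
    have h' := mul_le_mul_of_nonneg_right hdecay hpos.le
    nlinarith [mul_pos hpos hx0]
  have hC : 10 * Real.log K ^ 2 / (K : ℝ) ^ 2 = 10 * (Real.log K / K) ^ 2 := by ring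
  show _ ≤ _
  beta_reduce
  rw [hC]
  linarith
end

section
/- Fix a real number γ with 0 < γ < 1/2. For each even integer n with ⌈γn⌉ ≥ 3, define R^{(n)} : {⌈γn⌉,…,n/2+1} → ℝ by R^{(n)}_{n/2+1} = 0 and R^{(n)}_i = ((i−2)²/i²)·R^{(n)}_{i+1} + (2/n)·(1 − 1/i) for ⌈γn⌉ ≤ i ≤ n/2. Then R^{(n)}_{⌈γn⌉} converges, as n → ∞ along even integers, to 2γ/3 − 16γ⁴/3. -/
open Filter Topology

/-- The limiting profile, the solution of `x * g' x = 4 * g x - 2 * x` with `g (1 / 2) = 0`. -/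
noncomputable def limitProfile (x : ℝ) : ℝ := 2 * x / 3 - 16 * x ^ 4 / 3

theorem continuous_limitProfile : Continuous limitProfile := by
  unfold limitProfile
  fun_prop

theorem abs_le_abs_add_of_step {D : ℕ → ℝ} {δ : ℝ} {k : ℕ} (d : ℕ)
    (h : ∀ i, k ≤ i → i < k + d → |D i| ≤ |D (i + 1)| + δ) :
    |D k| ≤ |D (k + d)| + d * δ := by
  induction d with
  | zero => simp
  | succ d ih =>
    have h₁ := ih fun i hi hid => h i hi (by lia)
    have h₂ := h (k + d) (by lia) (by lia)
    push_cast
    rw [← add_assoc]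
    linarith

/-- One step of the recursion maps the limiting profile to itself up to a second order error. -/
theorem abs_limitProfile_step_le {γ x h : ℝ} (hγ : 0 < γ) (hx : γ ≤ x) (hx1 : x ≤ 1)
    (hh : 0 ≤ h) (hh1 : h ≤ 1) :
    |(x - 2 * h) ^ 2 / x ^ 2 * limitProfile (x + h) + 2 * h * (1 - h / x) - limitProfile x|
      ≤ 200 / γ ^ 2 * h ^ 2 := by
  have hx0 : 0 < x := hγ.trans_le hx
  have key : (x - 2 * h) ^ 2 / x ^ 2 * limitProfile (x + h) + 2 * h * (1 - h / x) - limitProfile x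
      = h ^ 2 * (8 * h / 3 - 2 * x - 16 / 3 * (-6 * x ^ 4 - 4 * (x ^ 3 * h) + 9 * (x ^ 2 * h ^ 2)
        + 12 * (x * h ^ 3) + 4 * h ^ 4)) / x ^ 2 := by
    unfold limitProfile
    field_simp
    ring
  have hmono (a b : ℕ) : 0 ≤ x ^ a * h ^ b ∧ x ^ a * h ^ b ≤ 1 :=
    ⟨by positivity, mul_le_one₀ (pow_le_one₀ hx0.le hx1) (by positivity) (pow_le_one₀ hh hh1)⟩
  have hP : |8 * h / 3 - 2 * x - 16 / 3 * (-6 * x ^ 4 - 4 * (x ^ 3 * h) + 9 * (x ^ 2 * h ^ 2)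
        + 12 * (x * h ^ 3) + 4 * h ^ 4)| ≤ 200 := by
    have h₁ := hmono 4 0
    have h₂ := hmono 3 1
    have h₃ := hmono 2 2
    have h₄ := hmono 1 3
    have h₅ := hmono 0 4
    simp only [pow_zero, pow_one, mul_one, one_mul] at h₁ h₂ h₃ h₄ h₅
    rw [abs_le]
    constructor <;> linarith [h₁.1, h₁.2, h₂.1, h₂.2, h₃.1, h₃.2, h₄.1, h₄.2, h₅.1, h₅.2]
  rw [key, abs_div, abs_mul, abs_of_nonneg (sq_nonneg h), abs_of_nonneg (sq_nonneg x)]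
  calc _ ≤ h ^ 2 * 200 / γ ^ 2 := by gcongr
    _ = _ := by ring

theorem abs_recursion_sub_limitProfile_le {γ : ℝ} (hγ0 : 0 < γ) (hγ : γ < 1 / 2) {n : ℕ}
    (hn : 0 < n) (heven : Even n) (hk : 3 ≤ ⌈γ * n⌉₊) {R : ℕ → ℝ} (hR0 : R (n / 2 + 1) = 0)
    (hR : ∀ i, ⌈γ * n⌉₊ ≤ i → i ≤ n / 2 →
      R i = (((i : ℝ) - 2) ^ 2 / (i : ℝ) ^ 2) * R (i + 1) + (2 / (n : ℝ)) * (1 - 1 / (i : ℝ))) :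
    |R ⌈γ * n⌉₊ - limitProfile (⌈γ * n⌉₊ / n)|
      ≤ |limitProfile (1 / 2 + 1 / n)| + 200 / γ ^ 2 * (1 / n) := by
  obtain ⟨m, rfl⟩ := heven.two_dvd
  rw [Nat.mul_div_cancel_left m two_pos] at hR0 hR
  set n := 2 * m with hnm
  have hn0 : (0 : ℝ) < n := by exact_mod_cast hn
  have hn1 : (1 : ℝ) ≤ n := by exact_mod_cast hn
  have hnm' : (n : ℝ) = 2 * m := by rw [hnm]; push_cast; ring
  have hkm : ⌈γ * n⌉₊ ≤ m := Nat.ceil_le.2 (by nlinarith)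
  have hkγ : γ * n ≤ ⌈γ * n⌉₊ := Nat.le_ceil _
  set k := ⌈γ * n⌉₊
  have hstep : ∀ i, k ≤ i → i < k + (m + 1 - k) →
      |R i - limitProfile (i / n)| ≤
        |R (i + 1) - limitProfile ((i + 1 : ℕ) / n)| + 200 / γ ^ 2 * (1 / n) ^ 2 := by
    intro i hki him
    have him' : (i : ℝ) ≤ m := by exact_mod_cast (by lia : i ≤ m)
    have hki' : (k : ℝ) ≤ i := by exact_mod_cast hki
    have hi3 : (3 : ℝ) ≤ i := by exact_mod_cast hk.trans hki
    have hi0 : (0 : ℝ) < i := by linarith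
    have herr := abs_limitProfile_step_le (x := i / n) (h := 1 / n) hγ0
      (by rw [le_div_iff₀ hn0]; linarith) (by rw [div_le_one hn0]; linarith)
      (by positivity) (by rw [div_le_one hn0]; exact hn1)
    have hcoef : ((i / n - 2 * (1 / n)) ^ 2 / (i / n) ^ 2 : ℝ) = (i - 2) ^ 2 / i ^ 2 := by
      field_simp
    have hinv : (1 / n / (i / n) : ℝ) = 1 / i := by field_simp
    have hnext : (i / n + 1 / n : ℝ) = (i + 1 : ℕ) / n := by push_cast; ring
    rw [hcoef, hinv, hnext] at herr
    have hcoef_le : ((i - 2) ^ 2 / i ^ 2 : ℝ) ≤ 1 := by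
      rw [div_le_one (by positivity)]
      nlinarith
    have hcoef_nonneg : (0 : ℝ) ≤ (i - 2) ^ 2 / i ^ 2 := by positivity
    rw [hR i hki (by lia)]
    set a : ℝ := (i - 2) ^ 2 / i ^ 2
    set y : ℝ := limitProfile ((i + 1 : ℕ) / n)
    calc _ = |a * (R (i + 1) - y) +
          (a * y + 2 * (1 / n) * (1 - 1 / i) - limitProfile (i / n))| := by congr 1; ring
      _ ≤ |a * (R (i + 1) - y)| + 200 / γ ^ 2 * (1 / n) ^ 2 :=
        (abs_add_le _ _).trans (by gcongr)
      _ ≤ _ := by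
        rw [abs_mul, abs_of_nonneg hcoef_nonneg]
        gcongr
        exact mul_le_of_le_one_left (abs_nonneg _) hcoef_le
  have hmain := abs_le_abs_add_of_step (D := fun i => R i - limitProfile (i / n)) _ hstep
  rw [show k + (m + 1 - k) = m + 1 by lia] at hmain
  have hend : ((m + 1 : ℕ) / n : ℝ) = 1 / 2 + 1 / n := by
    have hm0 : (0 : ℝ) < m := by linarith
    rw [hnm']
    push_cast
    field_simp
  simp only [hR0, hend, zero_sub, abs_neg] at hmain
  have hlen : ((m + 1 - k : ℕ) : ℝ) ≤ n := by exact_mod_cast (by lia : m + 1 - k ≤ n)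
  refine hmain.trans ?_
  refine add_le_add_right ?_ _
  calc ((m + 1 - k : ℕ) : ℝ) * (200 / γ ^ 2 * (1 / n) ^ 2)
      ≤ n * (200 / γ ^ 2 * (1 / n) ^ 2) := by gcongr
    _ = _ := by field_simp

/-- fix 0 < γ < 1/2. For even n, the backward recursion
    R_{n/2+1} = 0, R_i = ((i−2)²/i²)·R_{i+1} + (2/n)·(1 − 1/i) for ⌈γn⌉ ≤ i ≤ n/2,
    satisfies R_{⌈γn⌉} → 2γ/3 − 16γ⁴/3 as n → ∞ along even integers. -/
theorem stmt19 (γ : ℝ) (hγ0 : 0 < γ) (hγ : γ < 1 / 2) :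
    ∀ ε : ℝ, 0 < ε → ∃ N : ℕ, ∀ n : ℕ, N ≤ n → Even n → 3 ≤ ⌈γ * n⌉₊ →
      ∀ R : ℕ → ℝ, R (n / 2 + 1) = 0 →
        (∀ i, ⌈γ * n⌉₊ ≤ i → i ≤ n / 2 →
          R i = (((i : ℝ) - 2) ^ 2 / (i : ℝ) ^ 2) * R (i + 1) +
            (2 / (n : ℝ)) * (1 - 1 / (i : ℝ))) →
        |R ⌈γ * n⌉₊ - (2 * γ / 3 - 16 * γ ^ 4 / 3)| < ε := by
  have hinv : Tendsto (fun n : ℕ => (1 / n : ℝ)) atTop (𝓝 0) := tendsto_one_div_atTop_nhds_zero_nat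
  have hend : Tendsto (fun n : ℕ => limitProfile (1 / 2 + 1 / n)) atTop (𝓝 0) := by
    have h := (continuous_limitProfile.tendsto (1 / 2 + 0)).comp (hinv.const_add (1 / 2))
    rwa [show limitProfile (1 / 2 + 0) = 0 by norm_num [limitProfile]] at h
  have hstart : Tendsto (fun n : ℕ => limitProfile (⌈γ * n⌉₊ / n)) atTop (𝓝 (limitProfile γ)) :=
    (continuous_limitProfile.tendsto γ).comp
      ((tendsto_nat_ceil_mul_div_atTop hγ0.le).comp tendsto_natCast_atTop_atTop)
  have hbound : Tendsto (fun n : ℕ => |limitProfile (1 / 2 + 1 / n)| + 200 / γ ^ 2 * (1 / n) +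
      |limitProfile (⌈γ * n⌉₊ / n) - limitProfile γ|) atTop (𝓝 0) := by
    simpa using (hend.abs.add (hinv.const_mul (200 / γ ^ 2))).add (hstart.sub_const (limitProfile γ)).abs
  intro ε hε
  obtain ⟨N, hN⟩ := eventually_atTop.1
    ((hbound.eventually_lt_const hε).and (eventually_gt_atTop 0))
  refine ⟨N, fun n hn heven hk R hR0 hR => ?_⟩
  obtain ⟨hlt, hpos⟩ := hN n hn
  calc _ ≤ |R ⌈γ * n⌉₊ - limitProfile (⌈γ * n⌉₊ / n)| +
        |limitProfile (⌈γ * n⌉₊ / n) - limitProfile γ| := abs_sub_le _ _ _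
    _ ≤ _ := by
      gcongr
      exact abs_recursion_sub_limitProfile_le hγ0 hγ hpos heven hk hR0 hR
    _ < ε := hlt
end
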